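/- Let n ≥ 2 and let Ω ⊂ ℝⁿ be a bounded set of finite perimeter with 0 < H^{n−1}(∂Ω ∩ Ω¹) < ∞. Then there exists a set X ⊆ ∂Ω ∩ Ω¹ with H^{n−1}(X) = H^{n−1}(∂Ω ∩ Ω¹) such that for every x ∈ X: (i) lim_{r→0} P(Ω; B_r(x))/r^{n−1} = 0, and (ii) limsup_{r→0} H^{n−1}(X ∩ B_r(x))/(ω_{n−1} r^{n−1}) ≥ 2^{1−n}, where ω_{n−1} is the volume of the (n−1)-dimensional unit ball. -/

import Mathlib

open MeasureTheory Metric Filter Set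
open scoped ENNReal Topology NNReal

noncomputable section

/-- The divergence of a vector field `φ : ℝⁿ → ℝⁿ`. -/
def vdiv {n : ℕ} (φ : EuclideanSpace ℝ (Fin n) → EuclideanSpace ℝ (Fin n))
    (x : EuclideanSpace ℝ (Fin n)) : ℝ :=
  ∑ i, fderiv ℝ φ x (EuclideanSpace.single i 1) i

/-- The relative perimeter `P(E; W)` of a set `E` in an open set `W`, defined variationally as
`sup { ∫_E div φ : φ ∈ C¹_c(W; ℝⁿ), ‖φ‖_∞ ≤ 1 }`. -/
def relPerimeter {n : ℕ} (E W : Set (EuclideanSpace ℝ (Fin n))) : ℝ≥0∞ :=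
  ⨆ (φ : EuclideanSpace ℝ (Fin n) → EuclideanSpace ℝ (Fin n)) (_ : ContDiff ℝ 1 φ)
    (_ : HasCompactSupport φ) (_ : tsupport φ ⊆ W) (_ : ∀ x, ‖φ x‖ ≤ 1),
    ENNReal.ofReal (∫ x in E, vdiv φ x)

/-- The perimeter `P(E)` of a set `E ⊆ ℝⁿ`:
`P(E) = sup { ∫_E div φ : φ ∈ C¹_c(ℝⁿ; ℝⁿ), ‖φ‖_∞ ≤ 1 }`. -/
def perimeter {n : ℕ} (E : Set (EuclideanSpace ℝ (Fin n))) : ℝ≥0∞ :=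
  relPerimeter E Set.univ

/-- The set of points where `Ω` has Lebesgue density `α`; `densityPts Ω 1` is the
measure-theoretic interior `Ω¹` and `densityPts Ω 0` is the measure-theoretic exterior `Ω⁰`. -/
def densityPts {n : ℕ} (Ω : Set (EuclideanSpace ℝ (Fin n))) (α : ℝ≥0∞) :
    Set (EuclideanSpace ℝ (Fin n)) :=
  {x | Tendsto (fun r : ℝ => volume (Ω ∩ ball x r) / volume (ball x r)) (𝓝[>] 0) (𝓝 α)}

/-- A smooth set: a bounded open set whose topological boundary is a smooth hypersurface,
expressed via a smooth defining function with nonvanishing differential on the boundary. -/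
def IsSmoothSet {n : ℕ} (E : Set (EuclideanSpace ℝ (Fin n))) : Prop :=
  IsOpen E ∧ Bornology.IsBounded E ∧
  ∃ f : EuclideanSpace ℝ (Fin n) → ℝ, ContDiff ℝ (⊤ : ℕ∞) f ∧
    E = {x | f x < 0} ∧ frontier E = {x | f x = 0} ∧
    ∀ x ∈ frontier E, fderiv ℝ f x ≠ 0

/-- `E ⋐ Ω` : the closure of `E` is compact and contained in `Ω`. -/
def CpctContained {n : ℕ} (E Ω : Set (EuclideanSpace ℝ (Fin n))) : Prop :=
  IsCompact (closure E) ∧ closure E ⊆ Ω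

/-- `E_k → Ω` in `L¹`, i.e. `|E_k Δ Ω| → 0`. -/
def TendstoL1 {n : ℕ} (E : ℕ → Set (EuclideanSpace ℝ (Fin n)))
    (Ω : Set (EuclideanSpace ℝ (Fin n))) : Prop :=
  Tendsto (fun k => volume ((E k \ Ω) ∪ (Ω \ E k))) atTop (𝓝 0)

/-- The volume `ω_n` of the unit ball in ℝⁿ. -/
def unitBallVol (n : ℕ) : ℝ≥0∞ := volume (ball (0 : EuclideanSpace ℝ (Fin n)) 1)

section helpers

variable {n : ℕ}

lemma vdiv_continuous {φ : EuclideanSpace ℝ (Fin n) → EuclideanSpace ℝ (Fin n)}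
    (h : ContDiff ℝ 1 φ) : Continuous (vdiv φ) := by
  unfold vdiv
  have h1 : Continuous (fderiv ℝ φ) := h.continuous_fderiv one_ne_zero
  fun_prop

lemma vdiv_eq_zero {φ : EuclideanSpace ℝ (Fin n) → EuclideanSpace ℝ (Fin n)}
    {x : EuclideanSpace ℝ (Fin n)} (hx : x ∉ tsupport φ) : vdiv φ x = 0 := by
  unfold vdiv
  have : fderiv ℝ φ x = 0 := by
    by_contra hne
    exact hx (support_fderiv_subset ℝ hne)
  simp [this]

lemma vdiv_hcs {φ : EuclideanSpace ℝ (Fin n) → EuclideanSpace ℝ (Fin n)}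
    (hc : HasCompactSupport φ) : HasCompactSupport (vdiv φ) :=
  HasCompactSupport.intro hc (fun _ hx => vdiv_eq_zero hx)

lemma vdiv_integrable {φ : EuclideanSpace ℝ (Fin n) → EuclideanSpace ℝ (Fin n)}
    (h : ContDiff ℝ 1 φ) (hc : HasCompactSupport φ) : Integrable (vdiv φ) :=
  (vdiv_continuous h).integrable_of_hasCompactSupport (vdiv_hcs hc)

lemma vdiv_add {φ ψ : EuclideanSpace ℝ (Fin n) → EuclideanSpace ℝ (Fin n)}
    (h : ContDiff ℝ 1 φ) (h' : ContDiff ℝ 1 ψ) (x : EuclideanSpace ℝ (Fin n)) :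
    vdiv (fun y => φ y + ψ y) x = vdiv φ x + vdiv ψ x := by
  unfold vdiv
  rw [fderiv_fun_add (h.differentiable one_ne_zero x) (h'.differentiable one_ne_zero x)]
  simp [Finset.sum_add_distrib]

lemma vdiv_sub {φ ψ : EuclideanSpace ℝ (Fin n) → EuclideanSpace ℝ (Fin n)}
    (h : ContDiff ℝ 1 φ) (h' : ContDiff ℝ 1 ψ) (x : EuclideanSpace ℝ (Fin n)) :
    vdiv (fun y => φ y - ψ y) x = vdiv φ x - vdiv ψ x := by
  unfold vdiv
  rw [fderiv_fun_sub (h.differentiable one_ne_zero x) (h'.differentiable one_ne_zero x)]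
  simp [Finset.sum_sub_distrib]

lemma vdiv_sum {ι : Type*} (I : Finset ι)
    {φ : ι → EuclideanSpace ℝ (Fin n) → EuclideanSpace ℝ (Fin n)}
    (h : ∀ i ∈ I, ContDiff ℝ 1 (φ i)) (x : EuclideanSpace ℝ (Fin n)) :
    vdiv (fun y => ∑ i ∈ I, φ i y) x = ∑ i ∈ I, vdiv (φ i) x := by
  unfold vdiv
  rw [fderiv_fun_sum (fun i hi => (h i hi).differentiable one_ne_zero x), Finset.sum_comm]
  simp

lemma integral_vdiv_zero {φ : EuclideanSpace ℝ (Fin n) → EuclideanSpace ℝ (Fin n)}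
    (h : ContDiff ℝ 1 φ) (hc : HasCompactSupport φ) : ∫ x, vdiv φ x = 0 := by
  unfold vdiv
  have h1 : Continuous (fderiv ℝ φ) := h.continuous_fderiv one_ne_zero
  have hcs : ∀ i : Fin n, HasCompactSupport
      (fun x => fderiv ℝ φ x (EuclideanSpace.single i 1)) := fun i => hc.fderiv_apply ℝ _
  have hint : ∀ i : Fin n, Integrable
      (fun x => fderiv ℝ φ x (EuclideanSpace.single i 1)) := fun i =>
    Continuous.integrable_of_hasCompactSupport (by fun_prop) (hcs i)
  have hz : ∀ i : Fin n, ∫ x, fderiv ℝ φ x (EuclideanSpace.single i 1) = 0 := by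
    intro i
    have := integral_bilinear_fderiv_right_eq_neg_left_of_integrable
      (μ := (volume : Measure (EuclideanSpace ℝ (Fin n))))
      (f := fun _ => (1 : ℝ)) (g := φ) (v := EuclideanSpace.single i 1)
      (B := ContinuousLinearMap.lsmul ℝ ℝ) (by simp) (by simpa using hint i)
      (by simpa using h.continuous.integrable_of_hasCompactSupport hc)
      (fun x _ => by fun_prop) (fun x _ => h.differentiable one_ne_zero x)
    simpa using this
  have key : ∀ i : Fin n, ∫ x, (fderiv ℝ φ x (EuclideanSpace.single i 1)) i = 0 := by
    intro i
    have := (EuclideanSpace.proj i : EuclideanSpace ℝ (Fin n) →L[ℝ] ℝ).integral_comp_comm (hint i)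
    rw [hz i] at this
    simpa using this
  rw [integral_finsetSum]
  · simp [key]
  · intro i _
    exact (EuclideanSpace.proj i : EuclideanSpace ℝ (Fin n) →L[ℝ] ℝ).integrable_comp (hint i)

lemma abs_coord_le (v : EuclideanSpace ℝ (Fin n)) (i : Fin n) : |v i| ≤ ‖v‖ := by
  simpa using PiLp.norm_apply_le v i

lemma vdiv_smul_bound {η : EuclideanSpace ℝ (Fin n) → ℝ}
    {φ : EuclideanSpace ℝ (Fin n) → EuclideanSpace ℝ (Fin n)}
    (hη : ContDiff ℝ 1 η) (h : ContDiff ℝ 1 φ) (x : EuclideanSpace ℝ (Fin n)) {M K : ℝ}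
    (h1 : |η x| ≤ 1) (hM : |vdiv φ x| ≤ M) (hK : ‖fderiv ℝ η x‖ ≤ K) (hφ : ‖φ x‖ ≤ 1) :
    |vdiv (fun y => η y • φ y) x| ≤ M + n * K := by
  have e : vdiv (fun y => η y • φ y) x = η x * vdiv φ x +
      ∑ i, fderiv ℝ η x (EuclideanSpace.single i 1) * φ x i := by
    unfold vdiv
    rw [fderiv_fun_smul (hη.differentiable one_ne_zero x) (h.differentiable one_ne_zero x)]
    simp [Finset.sum_add_distrib, Finset.mul_sum]
  rw [e]
  refine (abs_add_le _ _).trans (add_le_add ?_ ?_)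
  · rw [abs_mul]
    calc |η x| * |vdiv φ x| ≤ 1 * |vdiv φ x| := by gcongr
      _ ≤ M := by simpa using hM
  · refine (Finset.abs_sum_le_sum_abs _ _).trans ?_
    calc ∑ i, |fderiv ℝ η x (EuclideanSpace.single i 1) * φ x i| ≤ ∑ i : Fin n, K := by
          refine Finset.sum_le_sum fun i _ => ?_
          rw [abs_mul]
          have a1 : |fderiv ℝ η x (EuclideanSpace.single i 1)| ≤ K := by
            have := (fderiv ℝ η x).le_opNorm (EuclideanSpace.single i 1)
            simp at this
            exact this.trans hK
          have a2 := (abs_coord_le (φ x) i).trans hφ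
          calc _ ≤ K * 1 := by gcongr; exact (norm_nonneg _).trans hK
            _ = K := mul_one _
      _ = n * K := by simp

/-- Uniform cutoffs. -/
lemma exists_cutoff (n : ℕ) : ∃ K : ℝ, 0 < K ∧ ∀ (c : EuclideanSpace ℝ (Fin n)) (s : ℝ), 0 < s →
    ∃ η : EuclideanSpace ℝ (Fin n) → ℝ, ContDiff ℝ 1 η ∧ (∀ x, |η x| ≤ 1) ∧ (∀ x, 0 ≤ η x) ∧
      (∀ x ∈ ball c s, η x = 1) ∧ tsupport η ⊆ closedBall c (2 * s) ∧
      ∀ x, ‖fderiv ℝ η x‖ ≤ K / s := by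
  let f : ContDiffBump (0 : EuclideanSpace ℝ (Fin n)) := ⟨1, 2, one_pos, one_lt_two⟩
  have hf : ContDiff ℝ 1 f := f.contDiff
  have hfs : HasCompactSupport (fderiv ℝ f) := f.hasCompactSupport.fderiv ℝ
  obtain ⟨K, hK⟩ := hfs.exists_bound_of_continuous (hf.continuous_fderiv one_ne_zero)
  refine ⟨|K| + 1, by positivity, fun c s hs => ?_⟩
  refine ⟨fun x => f (s⁻¹ • (x - c)), by fun_prop, fun x => ?_, fun x => f.nonneg, ?_, ?_, ?_⟩
  · rw [abs_of_nonneg f.nonneg]; exact f.le_one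
  · intro x hx
    apply f.one_of_mem_closedBall
    rw [mem_ball, dist_eq_norm] at hx
    simp only [mem_closedBall, dist_zero_right, norm_smul, norm_inv, Real.norm_eq_abs,
      abs_of_pos hs, f]
    rw [inv_mul_le_iff₀ hs]; linarith
  · apply closure_minimal _ isClosed_closedBall
    intro x hx
    by_contra hx'
    apply hx
    apply f.zero_of_le_dist
    simp only [mem_closedBall, dist_eq_norm, not_le] at hx'
    simp only [dist_zero_right, norm_smul, norm_inv, Real.norm_eq_abs,
      abs_of_pos hs, f]
    rw [le_inv_mul_iff₀ hs]; linarith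
  · intro x
    have hd : HasFDerivAt (fun x => s⁻¹ • (x - c))
        (s⁻¹ • ContinuousLinearMap.id ℝ (EuclideanSpace ℝ (Fin n))) x :=
      ((hasFDerivAt_id x).sub_const c).const_smul s⁻¹
    have := ((hf.differentiable one_ne_zero (s⁻¹ • (x - c))).hasFDerivAt.comp x hd).fderiv
    have e : fderiv ℝ (fun x => f (s⁻¹ • (x - c))) x =
      s⁻¹ • fderiv ℝ f (s⁻¹ • (x - c)) := by
      rw [show (fun x => f (s⁻¹ • (x - c))) = f ∘ (fun x => s⁻¹ • (x - c)) from rfl, this]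
      ext; simp
    rw [e, norm_smul, norm_inv, Real.norm_eq_abs, abs_of_pos hs, div_eq_inv_mul]
    gcongr
    exact (hK _).trans ((le_abs_self K).trans (by linarith))

lemma lt_relPerimeter {E W : Set (EuclideanSpace ℝ (Fin n))} {a : ℝ≥0∞}
    (h : a < relPerimeter E W) :
    ∃ φ : EuclideanSpace ℝ (Fin n) → EuclideanSpace ℝ (Fin n), ContDiff ℝ 1 φ ∧
      HasCompactSupport φ ∧ tsupport φ ⊆ W ∧ (∀ x, ‖φ x‖ ≤ 1) ∧
      a < ENNReal.ofReal (∫ x in E, vdiv φ x) := by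
  unfold relPerimeter at h
  simp only [lt_iSup_iff] at h
  obtain ⟨φ, h1, h2, h3, h4, h5⟩ := h
  exact ⟨φ, h1, h2, h3, h4, h5⟩

lemma le_perimeter {E : Set (EuclideanSpace ℝ (Fin n))} (hE : perimeter E ≠ ⊤)
    {φ : EuclideanSpace ℝ (Fin n) → EuclideanSpace ℝ (Fin n)} (h1 : ContDiff ℝ 1 φ)
    (h2 : HasCompactSupport φ) (h3 : ∀ x, ‖φ x‖ ≤ 1) :
    ∫ x in E, vdiv φ x ≤ (perimeter E).toReal := by
  rw [← ENNReal.ofReal_le_iff_le_toReal hE]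
  unfold perimeter relPerimeter
  exact le_iSup_of_le φ (le_iSup_of_le h1 (le_iSup_of_le h2 (le_iSup_of_le (subset_univ _)
    (le_iSup_of_le h3 le_rfl))))

lemma exists_near_perimeter {E : Set (EuclideanSpace ℝ (Fin n))} (hE : perimeter E ≠ ⊤)
    {ε : ℝ} (hε : 0 < ε) :
    ∃ φ : EuclideanSpace ℝ (Fin n) → EuclideanSpace ℝ (Fin n), ContDiff ℝ 1 φ ∧
      HasCompactSupport φ ∧ (∀ x, ‖φ x‖ ≤ 1) ∧
      (perimeter E).toReal - ε ≤ ∫ x in E, vdiv φ x := by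
  by_cases h0 : perimeter E = 0
  · refine ⟨fun _ => 0, contDiff_const, HasCompactSupport.zero, by simp, ?_⟩
    have : ∀ x, vdiv (fun _ : EuclideanSpace ℝ (Fin n) => (0 : EuclideanSpace ℝ (Fin n))) x = 0 := by
      intro x; simp [vdiv]
    simp [this, h0, hε.le]
  · have hp : 0 < (perimeter E).toReal := ENNReal.toReal_pos h0 hE
    have : ENNReal.ofReal ((perimeter E).toReal - ε) < perimeter E := by
      calc _ < ENNReal.ofReal (perimeter E).toReal :=
            (ENNReal.ofReal_lt_ofReal_iff hp).2 (by linarith)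
        _ = _ := ENNReal.ofReal_toReal hE
    obtain ⟨φ, h1, h2, -, h4, h5⟩ := lt_relPerimeter this
    exact ⟨φ, h1, h2, h4, ((ENNReal.ofReal_lt_ofReal_iff').1 h5).1.le⟩

end helpers

section core

variable {n : ℕ}

lemma cut_bound {Ω : Set (EuclideanSpace ℝ (Fin n))} (hm : MeasurableSet Ω)
    {ψ : EuclideanSpace ℝ (Fin n) → EuclideanSpace ℝ (Fin n)}
    (h : ContDiff ℝ 1 ψ) {c : EuclideanSpace ℝ (Fin n)} {R C : ℝ}
    (hs : tsupport ψ ⊆ closedBall c R) (hC : ∀ x, |vdiv ψ x| ≤ C) :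
    ∫ x in Ω, vdiv ψ x ≤ C * volume.real (closedBall c R \ Ω) := by
  have hc : HasCompactSupport ψ :=
    (isCompact_closedBall c R).of_isClosed_subset (isClosed_tsupport _) hs
  have hi := vdiv_integrable h hc
  have h1 := integral_add_compl hm hi
  rw [integral_vdiv_zero h hc] at h1
  have h2 : ∫ x in Ωᶜ, vdiv ψ x = ∫ x in closedBall c R \ Ω, vdiv ψ x := by
    apply setIntegral_eq_of_subset_of_forall_sdiff_eq_zero hm.compl
    · intro x hx; exact hx.2
    · intro x hx
      apply vdiv_eq_zero
      intro hx'
      exact hx.2 ⟨hs hx', hx.1⟩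
  have h3 : ‖∫ x in closedBall c R \ Ω, vdiv ψ x‖ ≤ C * volume.real (closedBall c R \ Ω) :=
    norm_setIntegral_le_of_norm_le_const
      ((measure_mono sdiff_subset).trans_lt measure_closedBall_lt_top) (fun x _ => hC x)
  rw [Real.norm_eq_abs] at h3
  have := neg_abs_le (∫ x in closedBall c R \ Ω, vdiv ψ x)
  linarith

lemma core_estimate (hn : 1 ≤ n) : ∃ K : ℝ, 0 < K ∧
    ∀ Ω : Set (EuclideanSpace ℝ (Fin n)), MeasurableSet Ω → perimeter Ω ≠ ⊤ →
    ∀ ε : ℝ, 0 < ε → ∃ δ : ℝ, 0 < δ ∧ ∀ (t κ : ℝ), 0 < t → 0 < κ →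
    ∀ I : Finset (EuclideanSpace ℝ (Fin n) × ℝ),
      (∀ p ∈ I, 0 < p.2 ∧ p.2 ≤ δ ∧ volume.real (closedBall p.1 (2 * p.2) \ Ω) ≤ κ * p.2 ^ n ∧
        ENNReal.ofReal (t * p.2 ^ (n - 1)) < relPerimeter Ω (ball p.1 p.2)) →
      ((I : Set (EuclideanSpace ℝ (Fin n) × ℝ)).PairwiseDisjoint
        fun p => closedBall p.1 (2 * p.2)) →
      (t - K * κ) * ∑ p ∈ I, p.2 ^ (n - 1) ≤ ε := by
  classical
  obtain ⟨K, hK, hcut⟩ := exists_cutoff n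
  refine ⟨n * K + 1, by positivity, fun Ω hm hper ε hε => ?_⟩
  obtain ⟨φ, hφ, hφc, hφ1, hφε⟩ := exists_near_perimeter hper hε
  obtain ⟨M, hM⟩ := (vdiv_hcs hφc).exists_bound_of_continuous (vdiv_continuous hφ)
  have hM0 : 0 ≤ M := (norm_nonneg _).trans (hM 0)
  refine ⟨1 / (M + 1), by positivity, fun t κ ht hκ I hI hd => ?_⟩
  -- choose data for each ball
  have hex : ∀ p : EuclideanSpace ℝ (Fin n) × ℝ,
      ∃ (η : EuclideanSpace ℝ (Fin n) → ℝ)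
        (ζ : EuclideanSpace ℝ (Fin n) → EuclideanSpace ℝ (Fin n)), p ∈ I →
      (ContDiff ℝ 1 η ∧ (∀ x, |η x| ≤ 1) ∧ (∀ x, 0 ≤ η x) ∧
      (∀ x ∈ ball p.1 p.2, η x = 1) ∧ tsupport η ⊆ closedBall p.1 (2 * p.2) ∧
      ∀ x, ‖fderiv ℝ η x‖ ≤ K / p.2) ∧
      (ContDiff ℝ 1 ζ ∧ HasCompactSupport ζ ∧ tsupport ζ ⊆ ball p.1 p.2 ∧ (∀ x, ‖ζ x‖ ≤ 1) ∧
        t * p.2 ^ (n - 1) ≤ ∫ x in Ω, vdiv ζ x) := by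
    intro p
    by_cases hp : p ∈ I
    · obtain ⟨h1, h2, h3, h4⟩ := hI p hp
      obtain ⟨η, hη⟩ := hcut p.1 p.2 h1
      obtain ⟨ζ, z1, z2, z3, z4, z5⟩ := lt_relPerimeter h4
      exact ⟨η, ζ, fun _ => ⟨hη, z1, z2, z3, z4, ((ENNReal.ofReal_lt_ofReal_iff').1 z5).1.le⟩⟩
    · exact ⟨fun _ => 0, fun _ => 0, fun h => absurd h hp⟩
  choose η ζ hηζ using hex
  let θ : EuclideanSpace ℝ (Fin n) × ℝ → EuclideanSpace ℝ (Fin n) → EuclideanSpace ℝ (Fin n) :=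
    fun p x => ζ p x - η p x • φ x
  have hηφ : ∀ p ∈ I, ContDiff ℝ 1 (fun x => η p x • φ x) := fun p hp =>
    (hηζ p hp).1.1.smul hφ
  have hηφs : ∀ p ∈ I, tsupport (fun x => η p x • φ x) ⊆ closedBall p.1 (2 * p.2) := fun p hp =>
    (tsupport_smul_subset_left (η p) φ).trans (hηζ p hp).1.2.2.2.2.1
  have hηφc : ∀ p ∈ I, HasCompactSupport (fun x => η p x • φ x) := fun p hp =>
    (isCompact_closedBall _ _).of_isClosed_subset (isClosed_tsupport _) (hηφs p hp)
  have hθ : ∀ p ∈ I, ContDiff ℝ 1 (θ p) := fun p hp => (hηζ p hp).2.1.sub (hηφ p hp)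
  have hθ0 : ∀ p ∈ I, ∀ x, x ∉ closedBall p.1 (2 * p.2) → θ p x = 0 := by
    intro p hp x hx
    have hp2 := (hI p hp).1
    have e1 : ζ p x = 0 := image_eq_zero_of_notMem_tsupport fun h => hx <|
      (ball_subset_closedBall.trans (closedBall_subset_closedBall (by linarith)))
        ((hηζ p hp).2.2.2.1 h)
    have e2 : η p x • φ x = 0 := image_eq_zero_of_notMem_tsupport (f := fun x => η p x • φ x)
      fun h => hx (hηφs p hp h)
    simp [θ, e1, e2]
  have hθc : ∀ p ∈ I, HasCompactSupport (θ p) := fun p hp =>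
    HasCompactSupport.intro (isCompact_closedBall _ _) (hθ0 p hp)
  have hθi : ∀ p ∈ I, t * p.2 ^ (n - 1) - (n * K + 1) * κ * p.2 ^ (n - 1) ≤
      ∫ x in Ω, vdiv (θ p) x := by
    intro p hp
    obtain ⟨h1, h2, h3, h4⟩ := hI p hp
    have e : ∫ x in Ω, vdiv (θ p) x = (∫ x in Ω, vdiv (ζ p) x) -
        ∫ x in Ω, vdiv (fun x => η p x • φ x) x := by
      rw [← integral_sub (vdiv_integrable (hηζ p hp).2.1 (hηζ p hp).2.2.1).integrableOn
        (vdiv_integrable (hηφ p hp) (hηφc p hp)).integrableOn]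
      exact integral_congr_ae (Eventually.of_forall fun x =>
        vdiv_sub (hηζ p hp).2.1 (hηφ p hp) x)
    have b := cut_bound hm (hηφ p hp) (hηφs p hp) (C := M + n * (K / p.2)) (fun x =>
      vdiv_smul_bound (hηζ p hp).1.1 hφ x ((hηζ p hp).1.2.1 x) (hM x)
        ((hηζ p hp).1.2.2.2.2.2 x) (hφ1 x))
    have b2 : (M + n * (K / p.2)) * volume.real (closedBall p.1 (2 * p.2) \ Ω) ≤
        (n * K + 1) * κ * p.2 ^ (n - 1) := by
      calc _ ≤ (M + n * (K / p.2)) * (κ * p.2 ^ n) := by gcongr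
        _ = (M * p.2 + n * K) * (κ * p.2 ^ (n - 1)) := by
          obtain ⟨m, rfl⟩ : ∃ m, n = m + 1 := ⟨n - 1, by omega⟩
          simp only [Nat.add_sub_cancel, pow_succ]
          field_simp
        _ ≤ (1 + n * K) * (κ * p.2 ^ (n - 1)) := by
          gcongr
          rw [le_div_iff₀ (by positivity)] at h2
          nlinarith
        _ = _ := by ring
    have := (hηζ p hp).2.2.2.2.2
    linarith
  let ψ : EuclideanSpace ℝ (Fin n) → EuclideanSpace ℝ (Fin n) := fun x => φ x + ∑ p ∈ I, θ p x
  have hS : ContDiff ℝ 1 (fun x => ∑ p ∈ I, θ p x) := ContDiff.sum fun p hp => hθ p hp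
  have hψ : ContDiff ℝ 1 ψ := hφ.add hS
  have hSc : HasCompactSupport (fun x => ∑ p ∈ I, θ p x) := by
    refine HasCompactSupport.intro (K := ⋃ p ∈ I, closedBall p.1 (2 * p.2))
      (I.isCompact_biUnion fun p _ => isCompact_closedBall _ _) fun x hx => ?_
    refine Finset.sum_eq_zero fun p hp => hθ0 p hp x fun h => hx ?_
    simp only [mem_iUnion]
    exact ⟨p, hp, h⟩
  have hψc : HasCompactSupport ψ := hφc.add hSc
  have hψ1 : ∀ x, ‖ψ x‖ ≤ 1 := by
    intro x
    by_cases hx : ∃ p ∈ I, x ∈ closedBall p.1 (2 * p.2)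
    · obtain ⟨p, hp, hxp⟩ := hx
      have es : ∑ q ∈ I, θ q x = θ p x := by
        refine Finset.sum_eq_single_of_mem p hp fun q hq hqp => hθ0 q hq x fun h => ?_
        exact (Set.disjoint_left.1 (hd hq hp hqp)) h hxp
      have e : ψ x = ζ p x + (1 - η p x) • φ x := by
        simp only [ψ, es, θ, sub_smul, one_smul]; abel
      rw [e]
      by_cases hb : x ∈ ball p.1 p.2
      · rw [(hηζ p hp).1.2.2.2.1 x hb]
        simpa using (hηζ p hp).2.2.2.2.1 x
      · rw [image_eq_zero_of_notMem_tsupport fun h => hb ((hηζ p hp).2.2.2.1 h), zero_add,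
          norm_smul, Real.norm_eq_abs]
        have a0 := (hηζ p hp).1.2.2.1 x
        have a1 := (abs_le.1 ((hηζ p hp).1.2.1 x)).2
        rw [abs_of_nonneg (by linarith)]
        have := hφ1 x
        have := norm_nonneg (φ x)
        nlinarith
    · push Not at hx
      have es : ∑ q ∈ I, θ q x = 0 := Finset.sum_eq_zero fun p hp => hθ0 p hp x (hx p hp)
      simp only [ψ, es, add_zero]
      exact hφ1 x
  have hfin := le_perimeter hper hψ hψc hψ1
  have e : ∫ x in Ω, vdiv ψ x = (∫ x in Ω, vdiv φ x) + ∑ p ∈ I, ∫ x in Ω, vdiv (θ p) x := by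
    rw [← integral_finsetSum _ fun p hp => (vdiv_integrable (hθ p hp) (hθc p hp)).integrableOn,
      ← integral_add (vdiv_integrable hφ hφc).integrableOn
      (integrable_finsetSum _ fun p hp => (vdiv_integrable (hθ p hp) (hθc p hp)).integrableOn)]
    refine integral_congr_ae (Eventually.of_forall fun x => ?_)
    simp only [ψ]
    rw [vdiv_add hφ hS, vdiv_sum I hθ]
  have hsum := Finset.sum_le_sum hθi
  have : (t - (n * K + 1) * κ) * ∑ p ∈ I, p.2 ^ (n - 1) =
      ∑ p ∈ I, (t * p.2 ^ (n - 1) - (n * K + 1) * κ * p.2 ^ (n - 1)) := by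
    rw [Finset.mul_sum]
    exact Finset.sum_congr rfl fun p _ => by ring
  linarith

end core

section nullsets

variable {n : ℕ}

lemma cast_dim (hn : 1 ≤ n) : (n : ℝ) - 1 = ((n - 1 : ℕ) : ℝ) := by
  rw [Nat.cast_sub hn]; simp

lemma hausdorff_null_of_cover (hn : 1 ≤ n) (A : Set (EuclideanSpace ℝ (Fin n)))
    (h : ∀ ε : ℝ, 0 < ε → ∃ u : Set (EuclideanSpace ℝ (Fin n) × ℝ), u.Countable ∧
      (∀ p ∈ u, 0 < p.2 ∧ p.2 ≤ ε) ∧ A ⊆ ⋃ p : u, closedBall p.1.1 p.1.2 ∧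
      ∑' p : u, ENNReal.ofReal (p.1.2 ^ (n - 1)) ≤ ENNReal.ofReal ε) :
    μH[(n : ℝ) - 1] A = 0 := by
  have hpos : ∀ k : ℕ, (0 : ℝ) < 1 / ((k : ℝ) + 1) := fun k => by positivity
  choose u hc hu hA hs using fun k : ℕ => h _ (hpos k)
  have : ∀ k, Countable (u k) := fun k => (hc k).to_subtype
  have hlim : Tendsto (fun k : ℕ => ENNReal.ofReal (1 / ((k : ℝ) + 1))) atTop (𝓝 0) := by
    simpa using ENNReal.tendsto_ofReal tendsto_one_div_add_atTop_nhds_zero_nat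
  have hlim2 : ∀ c : ℝ≥0∞, c ≠ ⊤ →
      Tendsto (fun k : ℕ => c * ENNReal.ofReal (1 / ((k : ℝ) + 1))) atTop (𝓝 0) := fun c hc => by
    simpa using ENNReal.Tendsto.const_mul hlim (Or.inr hc)
  have hdiam : ∀ k (p : u k), ediam (closedBall p.1.1 p.1.2) ≤ 2 * ENNReal.ofReal p.1.2 := by
    intro k p
    refine ediam_le fun x hx y hy => ?_
    have hp := (hu k _ p.2).1
    have e2 : 2 * ENNReal.ofReal p.1.2 = ENNReal.ofReal (2 * p.1.2) := by
      rw [ENNReal.ofReal_mul (by norm_num)]; simp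
    rw [edist_dist, e2]
    apply ENNReal.ofReal_le_ofReal
    have := dist_triangle_right x y p.1.1
    rw [mem_closedBall] at hx hy
    linarith
  have := Measure.hausdorffMeasure_le_liminf_tsum ((n : ℝ) - 1) A
    (fun k : ℕ => 2 * ENNReal.ofReal (1 / ((k : ℝ) + 1))) (hlim2 2 (by simp))
    (fun k (p : u k) => closedBall p.1.1 p.1.2)
    (Eventually.of_forall fun k p => (hdiam k p).trans
      (mul_le_mul_right (ENNReal.ofReal_le_ofReal (hu k _ p.2).2) 2))
    (Eventually.of_forall hA)
  refine le_antisymm (this.trans ?_) zero_le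
  rw [← (hlim2 (2 ^ (n - 1)) (by simp)).liminf_eq]
  refine liminf_le_liminf (Eventually.of_forall fun k => ?_)
  calc ∑' p : u k, ediam (closedBall p.1.1 p.1.2) ^ ((n : ℝ) - 1)
      ≤ ∑' p : u k, 2 ^ (n - 1) * ENNReal.ofReal (p.1.2 ^ (n - 1)) := by
        refine ENNReal.tsum_le_tsum fun p => ?_
        rw [cast_dim hn, ENNReal.rpow_natCast, ENNReal.ofReal_pow (hu k _ p.2).1.le, ← mul_pow]
        gcongr
        exact hdiam k p
    _ = 2 ^ (n - 1) * ∑' p : u k, ENNReal.ofReal (p.1.2 ^ (n - 1)) := ENNReal.tsum_mul_left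
    _ ≤ _ := by gcongr; exact hs k

lemma null_i (hn : 1 ≤ n) : ∃ c : ℝ, 0 < c ∧
    ∀ Ω : Set (EuclideanSpace ℝ (Fin n)), MeasurableSet Ω → perimeter Ω ≠ ⊤ →
    ∀ t ρ : ℝ, 0 < t → 0 < ρ → μH[(n : ℝ) - 1]
      {x : EuclideanSpace ℝ (Fin n) |
        (∃ᶠ r in 𝓝[>] (0 : ℝ), ENNReal.ofReal (t * r ^ (n - 1)) < relPerimeter Ω (ball x r)) ∧
        ∀ r, 0 < r → r < ρ → volume.real (ball x r \ Ω) ≤ c * t * r ^ n} = 0 := by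
  obtain ⟨K, hK, hcore⟩ := core_estimate hn
  refine ⟨1 / (2 * K * 3 ^ n), by positivity, fun Ω hm hper t ρ ht hρ => ?_⟩
  set A := {x : EuclideanSpace ℝ (Fin n) |
        (∃ᶠ r in 𝓝[>] (0 : ℝ), ENNReal.ofReal (t * r ^ (n - 1)) < relPerimeter Ω (ball x r)) ∧
        ∀ r, 0 < r → r < ρ → volume.real (ball x r \ Ω) ≤ 1 / (2 * K * 3 ^ n) * t * r ^ n} with hA
  apply hausdorff_null_of_cover hn
  intro ε hε
  obtain ⟨δ, hδ, hδ'⟩ := hcore Ω hm hper (t / 2 * (ε / 8 ^ (n - 1))) (by positivity)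
  specialize hδ' t (t / (2 * K)) ht (by positivity)
  set R := min δ (min (ρ / 4) (ε / 8)) with hR
  have hR0 : 0 < R := by positivity
  have hRδ : R ≤ δ := min_le_left _ _
  have hRρ : R ≤ ρ / 4 := (min_le_right _ _).trans (min_le_left _ _)
  have hRε : R ≤ ε / 8 := (min_le_right _ _).trans (min_le_right _ _)
  let T : Set (EuclideanSpace ℝ (Fin n) × ℝ) := {p | p.1 ∈ A ∧ 0 < p.2 ∧ p.2 ≤ R ∧
    ENNReal.ofReal (t * p.2 ^ (n - 1)) < relPerimeter Ω (ball p.1 p.2)}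
  obtain ⟨u, huT, hud, huc⟩ := Vitali.exists_disjoint_subfamily_covering_enlargement_closedBall T
    (fun p => p.1) (fun p => 2 * p.2) (2 * R) (fun p hp => by have := hp.2.2.1; linarith) 4
    (by norm_num)
  have hucount : u.Countable := by
    refine hud.countable_of_nonempty_interior fun p hp => ?_
    refine ⟨p.1, ball_subset_interior_closedBall (mem_ball_self ?_)⟩
    have := (huT hp).2.1
    linarith
  have hfinite : ∀ I : Finset (EuclideanSpace ℝ (Fin n) × ℝ), (I : Set _) ⊆ u →
      ∑ p ∈ I, p.2 ^ (n - 1) ≤ ε / 8 ^ (n - 1) := by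
    intro I hI
    have := hδ' I (fun p hp => ?_) (hud.subset hI)
    · have e : t - K * (t / (2 * K)) = t / 2 := by field_simp; ring
      rw [e] at this
      exact le_of_mul_le_mul_left this (by positivity)
    · obtain ⟨h1, h2, h3, h4⟩ := huT (hI hp)
      refine ⟨h2, h3.trans hRδ, ?_, h4⟩
      have := h1.2 (3 * p.2) (by positivity) (by linarith)
      calc volume.real (closedBall p.1 (2 * p.2) \ Ω) ≤ volume.real (ball p.1 (3 * p.2) \ Ω) := by
            refine measureReal_mono (sdiff_subset_sdiff_left
              (closedBall_subset_ball (by linarith)))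
              ((measure_mono sdiff_subset).trans_lt measure_ball_lt_top).ne
        _ ≤ _ := this
        _ = _ := by rw [mul_pow]; field_simp
  -- enlarge
  let g : EuclideanSpace ℝ (Fin n) × ℝ → EuclideanSpace ℝ (Fin n) × ℝ := fun p => (p.1, 8 * p.2)
  have hg : Function.Injective g := by
    intro p q h
    simp only [g, Prod.mk.injEq] at h
    exact Prod.ext h.1 (by linarith [h.2])
  refine ⟨g '' u, hucount.image g, ?_, ?_, ?_⟩
  · rintro _ ⟨p, hp, rfl⟩
    obtain ⟨h1, h2, h3, h4⟩ := huT hp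
    simp only [g]
    constructor <;> linarith
  · intro x hx
    obtain ⟨r, hr, hr1⟩ := (hx.1.and_eventually (Ioc_mem_nhdsGT hR0)).exists
    obtain ⟨b, hb, hsub⟩ := huc (x, r) ⟨hx, hr1.1, hr1.2, hr⟩
    rw [mem_iUnion]
    refine ⟨⟨g b, mem_image_of_mem g hb⟩, ?_⟩
    have := hsub (mem_closedBall_self (by have := hr1.1; simp; linarith))
    simp only [g]
    convert this using 2
    ring
  · have e : ∑' p : (g '' u), ENNReal.ofReal (p.1.2 ^ (n - 1)) =
        ∑' p : u, ENNReal.ofReal ((8 * p.1.2) ^ (n - 1)) :=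
      tsum_image (fun p : EuclideanSpace ℝ (Fin n) × ℝ => ENNReal.ofReal (p.2 ^ (n - 1)))
        hg.injOn
    rw [e, ENNReal.tsum_eq_iSup_sum]
    refine iSup_le fun J => ?_
    rw [← ENNReal.ofReal_sum_of_nonneg (fun p _ => by
      have := (huT p.2).2.1
      positivity)]
    apply ENNReal.ofReal_le_ofReal
    have := hfinite (J.map (Function.Embedding.subtype _)) (by
      intro p hp
      simp only [Finset.coe_map, Function.Embedding.subtype_apply, mem_image] at hp
      obtain ⟨q, -, rfl⟩ := hp
      exact q.2)
    rw [Finset.sum_map] at this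
    simp only [mul_pow, ← Finset.mul_sum]
    rw [le_div_iff₀ (by positivity)] at this
    simp only [Function.Embedding.subtype_apply] at this
    linarith

end nullsets

section densities

variable {n : ℕ}

lemma null_ii (hn : 2 ≤ n) (S : Set (EuclideanSpace ℝ (Fin n)))
    (hS : μH[(n : ℝ) - 1] S < ⊤) (θ : ℝ≥0∞) (hθ : θ < 1) (ρ : ℝ) (hρ : 0 < ρ) :
    μH[(n : ℝ) - 1] {x | x ∈ S ∧ ∀ r, 0 < r → r < ρ →
      μH[(n : ℝ) - 1] (S ∩ ball x r) ≤ θ * ENNReal.ofReal (r ^ (n - 1))} = 0 := by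
  set N := {x | x ∈ S ∧ ∀ r, 0 < r → r < ρ →
      μH[(n : ℝ) - 1] (S ∩ ball x r) ≤ θ * ENNReal.ofReal (r ^ (n - 1))} with hN
  have hθt : θ ≠ ⊤ := (hθ.trans ENNReal.one_lt_top).ne
  have hNS : N ⊆ S := fun x hx => hx.1
  have hNt : μH[(n : ℝ) - 1] N ≠ ⊤ := ((measure_mono hNS).trans_lt hS).ne
  by_contra h0
  have h1 : μH[(n : ℝ) - 1] N < μH[(n : ℝ) - 1] N / θ := by
    rw [ENNReal.lt_div_iff_mul_lt (Or.inr hNt) (Or.inl hθt)]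
    calc μH[(n : ℝ) - 1] N * θ < μH[(n : ℝ) - 1] N * 1 :=
          (ENNReal.mul_lt_mul_iff_right h0 hNt).2 hθ
      _ = _ := mul_one _
  obtain ⟨a, ha1, ha2⟩ := exists_between h1
  rw [ENNReal.lt_div_iff_mul_lt (Or.inr (ha2.trans_le le_top).ne) (Or.inl hθt)] at ha2
  have h2 : (⨅ (t : ℕ → Set (EuclideanSpace ℝ (Fin n))) (_ : N ⊆ ⋃ n, t n)
      (_ : ∀ n, ediam (t n) ≤ ENNReal.ofReal (ρ / 2)),
        ∑' k, ⨆ _ : (t k).Nonempty, ediam (t k) ^ ((n : ℝ) - 1)) < a := by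
    refine lt_of_le_of_lt ?_ ha1
    rw [Measure.hausdorffMeasure_apply]
    exact le_iSup₂_of_le (ENNReal.ofReal (ρ / 2)) (by simpa using hρ) le_rfl
  simp only [iInf_lt_iff] at h2
  obtain ⟨t, htN, htd, hta⟩ := h2
  have key : ∀ k, μH[(n : ℝ) - 1] (N ∩ t k) ≤
      θ * ⨆ _ : (t k).Nonempty, ediam (t k) ^ ((n : ℝ) - 1) := by
    intro k
    rcases (N ∩ t k).eq_empty_or_nonempty with he | ⟨x, hxN, hxt⟩
    · simp [he]
    · have hne : (t k).Nonempty := ⟨x, hxt⟩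
      rw [iSup_pos hne]
      have hDt : ediam (t k) ≠ ⊤ := ((htd k).trans_lt ENNReal.ofReal_lt_top).ne
      set D := (ediam (t k)).toReal with hD
      have hD0 : 0 ≤ D := ENNReal.toReal_nonneg
      have hDρ : D < ρ := by
        have : D ≤ ρ / 2 := ENNReal.toReal_le_of_le_ofReal (by positivity) (htd k)
        linarith
      have e : ediam (t k) ^ ((n : ℝ) - 1) = ENNReal.ofReal (D ^ (n - 1)) := by
        rw [cast_dim (by omega), ENNReal.rpow_natCast, ENNReal.ofReal_pow hD0,
          ENNReal.ofReal_toReal hDt]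
      rw [e]
      have hc : Tendsto (fun r : ℝ => θ * ENNReal.ofReal (r ^ (n - 1))) (𝓝[>] D)
          (𝓝 (θ * ENNReal.ofReal (D ^ (n - 1)))) := by
        refine Tendsto.mono_left ?_ nhdsWithin_le_nhds
        exact ENNReal.Tendsto.const_mul (ENNReal.tendsto_ofReal ((continuous_pow _).tendsto D))
          (Or.inr hθt)
      refine ge_of_tendsto hc ?_
      filter_upwards [Ioo_mem_nhdsGT hDρ] with r hr
      refine le_trans (measure_mono ?_) (hxN.2 r (hD0.trans_lt hr.1) hr.2)
      rintro y ⟨hyN, hyt⟩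
      refine ⟨hyN.1, ?_⟩
      rw [mem_ball, dist_edist]
      exact (ENNReal.toReal_mono hDt (edist_le_ediam_of_mem hyt hxt)).trans_lt hr.1
  have : μH[(n : ℝ) - 1] N ≤ a * θ := by
    calc μH[(n : ℝ) - 1] N ≤ μH[(n : ℝ) - 1] (⋃ k, N ∩ t k) := by
          rw [← inter_iUnion]
          exact measure_mono (subset_inter subset_rfl htN)
      _ ≤ ∑' k, μH[(n : ℝ) - 1] (N ∩ t k) := measure_iUnion_le _
      _ ≤ ∑' k, θ * ⨆ _ : (t k).Nonempty, ediam (t k) ^ ((n : ℝ) - 1) :=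
          ENNReal.tsum_le_tsum key
      _ = θ * ∑' k, ⨆ _ : (t k).Nonempty, ediam (t k) ^ ((n : ℝ) - 1) := ENNReal.tsum_mul_left
      _ ≤ θ * a := by gcongr
      _ = a * θ := mul_comm _ _
  exact absurd ha2 (not_lt.2 this)

lemma unitBallVol_le (m : ℕ) : unitBallVol m ≤ 2 ^ m := by
  unfold unitBallVol
  rw [← (PiLp.volume_preserving_toLp (Fin m)).measure_preimage
    measurableSet_ball.nullMeasurableSet]
  calc _ ≤ volume (Set.pi univ fun _ : Fin m => Ioo (-1 : ℝ) 1) := by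
        refine measure_mono fun x hx i _ => ?_
        simp only [mem_preimage, mem_ball, dist_zero_right] at hx
        have := (abs_coord_le (WithLp.toLp 2 x) i).trans_lt hx
        exact abs_lt.1 this
    _ = 2 ^ m := by
        rw [Real.volume_pi_Ioo]
        norm_num

lemma density_small (Ω : Set (EuclideanSpace ℝ (Fin n)))
    (hm : MeasurableSet Ω) (x : EuclideanSpace ℝ (Fin n)) (hx : x ∈ densityPts Ω 1)
    (κ : ℝ) (hκ : 0 < κ) :
    ∃ ρ : ℝ, 0 < ρ ∧ ∀ r, 0 < r → r < ρ → volume.real (ball x r \ Ω) ≤ κ * r ^ n := by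
  have h1 : Tendsto (fun r : ℝ => (volume (Ω ∩ ball x r) / volume (ball x r)).toReal)
      (𝓝[>] 0) (𝓝 (1 : ℝ≥0∞).toReal) := (ENNReal.tendsto_toReal ENNReal.one_ne_top).comp hx
  set ω := volume.real (ball (0 : EuclideanSpace ℝ (Fin n)) 1) with hω
  have hω0 : 0 < ω := ENNReal.toReal_pos (measure_ball_pos _ _ one_pos).ne' measure_ball_lt_top.ne
  have h2 := h1.eventually (lt_mem_nhds (a := 1 - κ / ω) (by simp; positivity))
  obtain ⟨ρ, hρ, hsub⟩ := mem_nhdsGT_iff_exists_Ioo_subset.1 h2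
  refine ⟨ρ, hρ, fun r hr0 hrρ => ?_⟩
  have h3 : 1 - κ / ω < (volume (Ω ∩ ball x r) / volume (ball x r)).toReal := hsub ⟨hr0, hrρ⟩
  rw [ENNReal.toReal_div] at h3
  change 1 - κ / ω < volume.real (Ω ∩ ball x r) / volume.real (ball x r) at h3
  have hv : volume.real (ball x r) = r ^ n * ω := by
    rw [hω, measureReal_def, measureReal_def, Measure.addHaar_ball_of_pos _ _ hr0,
      ENNReal.toReal_mul, ENNReal.toReal_ofReal (by positivity)]
    simp
  have hvp : 0 < volume.real (ball x r) := by rw [hv]; positivity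
  rw [lt_div_iff₀ hvp] at h3
  have h4 := measureReal_inter_add_sdiff (μ := volume) (s := ball x r) hm measure_ball_lt_top.ne
  rw [inter_comm] at h4
  have : (1 - κ / ω) * (r ^ n * ω) = r ^ n * ω - κ * r ^ n := by field_simp
  rw [hv] at h3 h4
  linarith

end densities


/-- If `Ω ⊆ ℝⁿ` (`n ≥ 2`) is a bounded set of finite perimeter with
`0 < H^{n-1}(∂Ω ∩ Ω¹) < ∞`, then there is `X ⊆ ∂Ω ∩ Ω¹` of full `H^{n-1}` measure in
`∂Ω ∩ Ω¹` such that at every `x ∈ X`: (i) `P(Ω; B_r(x))/r^{n-1} → 0` as `r → 0`, and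
(ii) `limsup_{r→0} H^{n-1}(X ∩ B_r(x)) / (ω_{n-1} r^{n-1}) ≥ 2^{1-n}`. -/
theorem density_points_of_interior_boundary (n : ℕ) (hn : 2 ≤ n)
    (Ω : Set (EuclideanSpace ℝ (Fin n)))
    (hb : Bornology.IsBounded Ω) (hm : MeasurableSet Ω) (hper : perimeter Ω ≠ ⊤)
    (hpos : 0 < μH[(n : ℝ) - 1] (frontier Ω ∩ densityPts Ω 1))
    (hfin : μH[(n : ℝ) - 1] (frontier Ω ∩ densityPts Ω 1) < ⊤) :
    ∃ X : Set (EuclideanSpace ℝ (Fin n)),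
      X ⊆ frontier Ω ∩ densityPts Ω 1 ∧
      μH[(n : ℝ) - 1] X = μH[(n : ℝ) - 1] (frontier Ω ∩ densityPts Ω 1) ∧
      ∀ x ∈ X,
        Tendsto (fun r : ℝ => relPerimeter Ω (ball x r) / ENNReal.ofReal (r ^ (n - 1)))
          (𝓝[>] 0) (𝓝 0) ∧
        1 / 2 ^ (n - 1) ≤
          Filter.limsup
            (fun r : ℝ => μH[(n : ℝ) - 1] (X ∩ ball x r) /
              (unitBallVol (n - 1) * ENNReal.ofReal (r ^ (n - 1)))) (𝓝[>] 0) := by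
  have hn1 : 1 ≤ n := by omega
  set S := frontier Ω ∩ densityPts Ω 1 with hSdef
  obtain ⟨c, hc, hnull⟩ := null_i hn1
  have hq : ∀ k : ℕ, (0 : ℝ) < 1 / ((k : ℝ) + 1) := fun k => by positivity
  obtain ⟨u, -, hulim, huu⟩ : ∃ u : ℕ → ℝ≥0∞, StrictMono u ∧
      Tendsto u atTop (𝓝 (1 / 2 ^ (n - 1))) ∧ ∀ k, u k < 1 / 2 ^ (n - 1) := by
    obtain ⟨u, h1, h2, h3⟩ := exists_seq_strictMono_tendsto' (x := (1 / 2 ^ (n - 1) : ℝ≥0∞))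
      (y := 0) (by simp)
    exact ⟨u, h1, h3, fun k => (h2 k).2⟩
  have hθ : ∀ k, u k * unitBallVol (n - 1) < 1 := by
    intro k
    have h1 := huu k
    rw [ENNReal.lt_div_iff_mul_lt (Or.inl (by simp)) (Or.inl (by simp))] at h1
    exact (mul_le_mul_right (unitBallVol_le (n - 1)) _).trans_lt h1
  let N1 : Set (EuclideanSpace ℝ (Fin n)) := ⋃ (k : ℕ) (m : ℕ),
    {x : EuclideanSpace ℝ (Fin n) |
        (∃ᶠ r in 𝓝[>] (0 : ℝ), ENNReal.ofReal (1 / ((k : ℝ) + 1) * r ^ (n - 1)) <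
          relPerimeter Ω (ball x r)) ∧
        ∀ r, 0 < r → r < 1 / ((m : ℝ) + 1) →
          volume.real (ball x r \ Ω) ≤ c * (1 / ((k : ℝ) + 1)) * r ^ n}
  let N2 : Set (EuclideanSpace ℝ (Fin n)) := ⋃ (k : ℕ) (m : ℕ),
    {x | x ∈ S ∧ ∀ r, 0 < r → r < 1 / ((m : ℝ) + 1) →
      μH[(n : ℝ) - 1] (S ∩ ball x r) ≤ u k * unitBallVol (n - 1) * ENNReal.ofReal (r ^ (n - 1))}
  have hN1 : μH[(n : ℝ) - 1] N1 = 0 := by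
    simp only [N1, measure_iUnion_null_iff]
    exact fun k m => hnull Ω hm hper _ _ (hq k) (hq m)
  have hN2 : μH[(n : ℝ) - 1] N2 = 0 := by
    simp only [N2, measure_iUnion_null_iff]
    exact fun k m => null_ii hn S hfin _ (hθ k) _ (hq m)
  have hN : μH[(n : ℝ) - 1] (N1 ∪ N2) = 0 := measure_union_null hN1 hN2
  refine ⟨S \ (N1 ∪ N2), sdiff_subset, measure_sdiff_null hN, ?_⟩
  rintro x ⟨hxS, hxN⟩
  have hx1 : x ∉ N1 := fun h => hxN (Or.inl h)
  have hx2 : x ∉ N2 := fun h => hxN (Or.inr h)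
  constructor
  · by_contra hcon
    rw [ENNReal.tendsto_nhds_zero] at hcon
    push Not at hcon
    obtain ⟨ε, hε, hfr⟩ := hcon
    obtain ⟨k, hk⟩ : ∃ k : ℕ, ENNReal.ofReal (1 / ((k : ℝ) + 1)) < ε := by
      have hlim : Tendsto (fun k : ℕ => ENNReal.ofReal (1 / ((k : ℝ) + 1))) atTop (𝓝 0) := by
        simpa using ENNReal.tendsto_ofReal tendsto_one_div_add_atTop_nhds_zero_nat
      exact (hlim.eventually (gt_mem_nhds hε)).exists
    obtain ⟨ρ, hρ, hρ'⟩ := density_small Ω hm x hxS.2 (c * (1 / ((k : ℝ) + 1)))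
      (mul_pos hc (hq k))
    obtain ⟨m, hmρ⟩ := exists_nat_one_div_lt hρ
    apply hx1
    simp only [N1, mem_iUnion]
    refine ⟨k, m, ?_, fun r h1 h2 => hρ' r h1 (h2.trans hmρ)⟩
    refine (hfr.and_eventually self_mem_nhdsWithin).mono ?_
    rintro r ⟨h1, h2⟩
    have h2' : (0 : ℝ) < r := h2
    have h3 : ENNReal.ofReal (r ^ (n - 1)) ≠ 0 := by
      simp only [ne_eq, ENNReal.ofReal_eq_zero, not_le]; positivity
    have h4 := hk.trans h1
    rw [ENNReal.lt_div_iff_mul_lt (Or.inl h3) (Or.inl ENNReal.ofReal_ne_top)] at h4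
    rwa [ENNReal.ofReal_mul (hq k).le]
  · have hXS : ∀ r, μH[(n : ℝ) - 1] ((S \ (N1 ∪ N2)) ∩ ball x r) =
        μH[(n : ℝ) - 1] (S ∩ ball x r) := by
      intro r
      rw [show (S \ (N1 ∪ N2)) ∩ ball x r = (S ∩ ball x r) \ (N1 ∪ N2) by
        ext y; simp only [mem_inter_iff, Set.mem_sdiff]; tauto]
      exact measure_sdiff_null hN
    by_contra hcon
    rw [not_le] at hcon
    obtain ⟨k, hk⟩ := (hulim.eventually (lt_mem_nhds hcon)).exists
    have hev := eventually_lt_of_limsup_lt hk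
    obtain ⟨ρ, hρ, hsub⟩ := mem_nhdsGT_iff_exists_Ioo_subset.1 hev
    obtain ⟨m, hmρ⟩ := exists_nat_one_div_lt (show (0 : ℝ) < ρ from hρ)
    apply hx2
    simp only [N2, mem_iUnion]
    refine ⟨k, m, hxS, fun r h1 h2 => ?_⟩
    have h3 : μH[(n : ℝ) - 1] ((S \ (N1 ∪ N2)) ∩ ball x r) /
              (unitBallVol (n - 1) * ENNReal.ofReal (r ^ (n - 1))) < u k :=
      hsub ⟨h1, h2.trans hmρ⟩
    rw [hXS] at h3
    have hw0 : unitBallVol (n - 1) ≠ 0 := (measure_ball_pos _ _ one_pos).ne'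
    have hwt : unitBallVol (n - 1) ≠ ⊤ := measure_ball_lt_top.ne
    have h4 : ENNReal.ofReal (r ^ (n - 1)) ≠ 0 := by
      simp only [ne_eq, ENNReal.ofReal_eq_zero, not_le]; positivity
    have h5 := (ENNReal.div_le_iff (mul_ne_zero hw0 h4)
      (ENNReal.mul_ne_top hwt ENNReal.ofReal_ne_top)).1 h3.le
    rwa [← mul_assoc] at h5
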